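/- arXiv:2301.10806 — 5 statements merged into one kernel-verified Lean document; each statement's English description precedes it below -/
import Mathlib

section
/- For every symmetric bilinear map μ ∈ V_n and every Hermitian matrix A ∈ gl(n,ℂ), one has ⟨A·μ, μ⟩ = Tr(M_μ A), where A·μ is the infinitesimal change-of-basis action and M_μ is the moment matrix of μ. In other words, the matrix M_μ = −2 ∑_{i=1}^n (L^μ_{x_i})* L^μ_{x_i} + ∑_{i=1}^n L^μ_{x_i}(L^μ_{x_i})* represents the moment map of the GL(n,ℂ)-action on V_n at μ. -/
open Matrix

noncomputable section

/-- `Vn n` is the space of `n`-dimensional commutative complex algebras, i.e. symmetric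
ℂ-bilinear maps `ℂⁿ × ℂⁿ → ℂⁿ`, encoded by structure constants with respect to the
standard basis: `μ i j k` is the `e k`-coordinate of `μ(e i, e j)`. -/
abbrev Vn (n : ℕ) : Type := Fin n → Fin n → Fin n → ℂ

namespace Vn

variable {n : ℕ}

/-- symmetry (commutativity) of the multiplication -/
def IsSymm (μ : Vn n) : Prop := ∀ i j k, μ i j k = μ j i k

/-- the product `μ(x, y)` -/
def mul (μ : Vn n) (x y : Fin n → ℂ) : Fin n → ℂ :=
  fun k => ∑ i, ∑ j, x i * y j * μ i j k

/-- left multiplication `L^μ_x`, as a matrix -/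
def L (μ : Vn n) (x : Fin n → ℂ) : Matrix (Fin n) (Fin n) ℂ :=
  Matrix.of fun k j => ∑ i, x i * μ i j k

/-- the standard Hermitian inner product on `ℂⁿ` (linear in the first variable) -/
def herm (x y : Fin n → ℂ) : ℂ := ∑ i, x i * star (y i)

/-- the moment matrix `M_μ = -2 ∑ᵢ (L_{xᵢ})* L_{xᵢ} + ∑ᵢ L_{xᵢ} (L_{xᵢ})*`,
computed with respect to the standard orthonormal basis of `ℂⁿ` -/
def Mmat (μ : Vn n) : Matrix (Fin n) (Fin n) ℂ :=
  (-2 : ℂ) • ∑ i, (L μ (Pi.single i 1))ᴴ * L μ (Pi.single i 1)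
    + ∑ i, L μ (Pi.single i 1) * (L μ (Pi.single i 1))ᴴ

/-- the Hermitian product on `Vn n` -/
def innerV (μ ν : Vn n) : ℂ := ∑ i, ∑ j, ∑ k, μ i j k * star (ν i j k)

/-- the squared norm `‖μ‖²` on `Vn n` -/
def normSqV (μ : Vn n) : ℝ := ∑ i, ∑ j, ∑ k, Complex.normSq (μ i j k)

/-- the infinitesimal change-of-basis action of `gl(n, ℂ)` on `Vn n`:
`(A·μ)(x,y) = A(μ(x,y)) - μ(Ax,y) - μ(x,Ay)` -/
def glAct (A : Matrix (Fin n) (Fin n) ℂ) (μ : Vn n) : Vn n :=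
  fun i j k =>
    (A *ᵥ mul μ (Pi.single i 1) (Pi.single j 1)
      - mul μ (A *ᵥ Pi.single i 1) (Pi.single j 1)
      - mul μ (Pi.single i 1) (A *ᵥ Pi.single j 1)) k

/-- the change-of-basis action of `GL(n, ℂ)` on `Vn n`:
`(g·μ)(x,y) = g(μ(g⁻¹x, g⁻¹y))` -/
def gAct (g : GL (Fin n) ℂ) (μ : Vn n) : Vn n :=
  fun i j k =>
    ((g : Matrix (Fin n) (Fin n) ℂ) *ᵥ
      mul μ ((↑g⁻¹ : Matrix (Fin n) (Fin n) ℂ) *ᵥ Pi.single i 1)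
            ((↑g⁻¹ : Matrix (Fin n) (Fin n) ℂ) *ᵥ Pi.single j 1)) k

/-- the `GL(n,ℂ)`-orbit (isomorphism class) of `μ` -/
def orbit (μ : Vn n) : Set (Vn n) := { ν | ∃ g : GL (Fin n) ℂ, ν = gAct g μ }

/-- `D` is a derivation of `μ` -/
def IsDeriv (μ : Vn n) (D : Matrix (Fin n) (Fin n) ℂ) : Prop :=
  ∀ x y, D *ᵥ mul μ x y = mul μ (D *ᵥ x) y + mul μ x (D *ᵥ y)

/-- the associator `(a,b,c) = (ab)c - a(bc)` -/
def assoc (μ : Vn n) (a b c : Fin n → ℂ) : Fin n → ℂ :=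
  mul μ (mul μ a b) c - mul μ a (mul μ b c)

/-- `μ` is a Jordan algebra: commutative and satisfying the linearized Jordan identity
`(ab,c,d) + (bd,c,a) + (da,c,b) = 0` -/
def IsJordan (μ : Vn n) : Prop :=
  IsSymm μ ∧ ∀ a b c d : Fin n → ℂ,
    assoc μ (mul μ a b) c d + assoc μ (mul μ b d) c a + assoc μ (mul μ d a) c b = 0

/-- `μ` is a soliton: `μ ≠ 0` and `M_μ · μ ∈ ℝ μ` -/
def IsSoliton (μ : Vn n) : Prop :=
  μ ≠ 0 ∧ ∃ c : ℝ, glAct (Mmat μ) μ = (c : ℂ) • μ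

/-- the constant `c_μ = -Tr(M_μ²)/‖μ‖²` -/
def cconst (μ : Vn n) : ℝ := -(Matrix.trace (Mmat μ * Mmat μ)).re / normSqV μ

/-- `D_μ = M_μ - c_μ • I` -/
def Dmat (μ : Vn n) : Matrix (Fin n) (Fin n) ℂ := Mmat μ - (cconst μ : ℂ) • 1

/-- the energy `E_n(μ) = Tr(M_μ²)/‖μ‖⁴` -/
def energy (μ : Vn n) : ℝ := (Matrix.trace (Mmat μ * Mmat μ)).re / (normSqV μ) ^ 2

/-- the trace form `τ_μ(x, y) = Tr L_{μ(x,y)}` -/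
def traceForm (μ : Vn n) (x y : Fin n → ℂ) : ℂ := Matrix.trace (L μ (mul μ x y))

/-- nondegeneracy of the trace form (Albert's criterion for semisimplicity) -/
def TraceFormNondeg (μ : Vn n) : Prop := ∀ x, (∀ y, traceForm μ x y = 0) → x = 0

end Vn


namespace Vn

variable {n : ℕ}

lemma L_single (μ : Vn n) (i k j : Fin n) : L μ (Pi.single i 1) k j = μ i j k := by
  simp [L, Pi.single_apply]

lemma glAct_apply (A : Matrix (Fin n) (Fin n) ℂ) (μ : Vn n) (i j k : Fin n) :
    glAct A μ i j k =
      ∑ l, A k l * μ i j l - ∑ l, A l i * μ l j k - ∑ l, A l j * μ i l k := by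
  simp [glAct, mul, Matrix.mulVec, dotProduct, Pi.single_apply]

lemma trace_L_mul_conjTranspose_mul (μ : Vn n) (A : Matrix (Fin n) (Fin n) ℂ) (i : Fin n) :
    trace (L μ (Pi.single i 1) * (L μ (Pi.single i 1))ᴴ * A) =
      ∑ j, ∑ k, (∑ l, A k l * μ i j l) * star (μ i j k) := by
  simp only [trace, diag, Matrix.mul_apply, conjTranspose_apply, L_single, Finset.sum_mul]
  rw [Finset.sum_congr rfl fun _ _ => Finset.sum_comm, Finset.sum_comm]
  refine Finset.sum_congr rfl fun j _ => ?_
  rw [Finset.sum_comm]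
  exact Finset.sum_congr rfl fun k _ => Finset.sum_congr rfl fun l _ => by ring

lemma trace_conjTranspose_mul_L_mul (μ : Vn n) (A : Matrix (Fin n) (Fin n) ℂ) (i : Fin n) :
    trace ((L μ (Pi.single i 1))ᴴ * L μ (Pi.single i 1) * A) =
      ∑ j, ∑ k, (∑ l, A l j * μ i l k) * star (μ i j k) := by
  simp only [trace, diag, Matrix.mul_apply, conjTranspose_apply, L_single, Finset.sum_mul]
  refine Finset.sum_congr rfl fun j _ => ?_
  rw [Finset.sum_comm]
  exact Finset.sum_congr rfl fun k _ => Finset.sum_congr rfl fun l _ => by ring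

lemma IsSymm.sum_left_eq_sum_right {μ : Vn n} (hμ : IsSymm μ) (A : Matrix (Fin n) (Fin n) ℂ) :
    ∑ i, ∑ j, ∑ k, (∑ l, A l i * μ l j k) * star (μ i j k) =
      ∑ i, ∑ j, ∑ k, (∑ l, A l j * μ i l k) * star (μ i j k) := by
  rw [Finset.sum_comm]
  refine Finset.sum_congr rfl fun i _ => Finset.sum_congr rfl fun j _ =>
    Finset.sum_congr rfl fun k _ => ?_
  rw [hμ j i k, Finset.sum_congr rfl fun l _ => by rw [hμ l i k]]

end Vn

/-- for every symmetric `μ ∈ V_n` and every Hermitian matrix `A`,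
`⟨A·μ, μ⟩ = Tr(M_μ A)`: the moment matrix `M_μ` represents the moment map at `μ`. -/
theorem stmt0 {n : ℕ} (μ : Vn n) (hμ : Vn.IsSymm μ)
    (A : Matrix (Fin n) (Fin n) ℂ) (hA : A.IsHermitian) :
    Vn.innerV (Vn.glAct A μ) μ = Matrix.trace (Vn.Mmat μ * A) := by
  have hM : trace (Vn.Mmat μ * A) =
      -2 * ∑ i, trace ((Vn.L μ (Pi.single i 1))ᴴ * Vn.L μ (Pi.single i 1) * A) +
        ∑ i, trace (Vn.L μ (Pi.single i 1) * (Vn.L μ (Pi.single i 1))ᴴ * A) := by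
    simp only [Vn.Mmat, Matrix.add_mul, Matrix.smul_mul, Finset.sum_mul, trace_add, trace_smul,
      trace_sum, smul_eq_mul]
  simp only [hM, Vn.trace_L_mul_conjTranspose_mul, Vn.trace_conjTranspose_mul_L_mul, Vn.innerV,
    Vn.glAct_apply, sub_mul, Finset.sum_sub_distrib, hμ.sum_left_eq_sum_right A]
  ring
end
end

section
/- A nonzero μ ∈ V_n is a soliton (i.e., M_μ·μ ∈ ℝ·μ for the gl(n,ℂ)-action) if and only if D_μ := M_μ − c_μ·I is a derivation of μ, where c_μ := −Tr(M_μ²)/‖μ‖². In this case c_μ < 0 and D_μ is Hermitian with respect to the standard Hermitian product on ℂⁿ. -/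
open Matrix

noncomputable section

namespace Vn

variable {n : ℕ}

lemma mul_glAct (A : Matrix (Fin n) (Fin n) ℂ) (μ : Vn n) (x y : Fin n → ℂ) :
    mul (glAct A μ) x y = A *ᵥ mul μ x y - mul μ (A *ᵥ x) y - mul μ x (A *ᵥ y) := by
  ext k
  have h₁ : (A *ᵥ mul μ x y) k = ∑ i, ∑ j, x i * y j * ∑ l, A k l * μ i j l := by
    simp only [Matrix.mulVec, dotProduct, mul, Finset.mul_sum]
    rw [Finset.sum_comm]
    refine Finset.sum_congr rfl fun i _ => ?_
    rw [Finset.sum_comm]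
    exact Finset.sum_congr rfl fun j _ => Finset.sum_congr rfl fun l _ => by ring
  have h₂ : mul μ (A *ᵥ x) y k = ∑ i, ∑ j, x i * y j * ∑ l, A l i * μ l j k := by
    simp only [Matrix.mulVec, dotProduct, mul, Finset.mul_sum, Finset.sum_mul]
    rw [Finset.sum_comm]
    conv_rhs => rw [Finset.sum_comm]
    refine Finset.sum_congr rfl fun j _ => ?_
    rw [Finset.sum_comm]
    exact Finset.sum_congr rfl fun i _ => Finset.sum_congr rfl fun l _ => by ring
  have h₃ : mul μ x (A *ᵥ y) k = ∑ i, ∑ j, x i * y j * ∑ l, A l j * μ i l k := by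
    simp only [Matrix.mulVec, dotProduct, mul, Finset.mul_sum, Finset.sum_mul]
    refine Finset.sum_congr rfl fun i _ => ?_
    rw [Finset.sum_comm]
    exact Finset.sum_congr rfl fun j _ => Finset.sum_congr rfl fun l _ => by ring
  rw [Pi.sub_apply, Pi.sub_apply, h₁, h₂, h₃]
  simp only [mul, glAct_apply, mul_sub, Finset.sum_sub_distrib]

lemma isDeriv_iff_glAct_eq_zero (μ : Vn n) (D : Matrix (Fin n) (Fin n) ℂ) :
    IsDeriv μ D ↔ glAct D μ = 0 := by
  constructor
  · intro h
    funext i j k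
    simp [glAct, h (Pi.single i 1) (Pi.single j 1)]
  · intro h x y
    have hxy := mul_glAct D μ x y
    have h_zero : mul (0 : Vn n) x y = 0 := by ext k; simp [mul]
    rwa [h, h_zero, eq_comm, sub_sub, sub_eq_zero] at hxy

lemma glAct_sub_smul_one (A : Matrix (Fin n) (Fin n) ℂ) (c : ℂ) (μ : Vn n) :
    glAct (A - c • 1) μ = glAct A μ + c • μ := by
  funext i j k
  simp only [glAct_apply, Pi.add_apply, Pi.smul_apply, smul_eq_mul, Matrix.sub_apply,
    Matrix.smul_apply, Matrix.one_apply, sub_mul, Finset.sum_sub_distrib]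
  simp
  ring

lemma Mmat_apply (μ : Vn n) (a b : Fin n) :
    Mmat μ a b = -2 * ∑ i, ∑ k, star (μ i a k) * μ i b k
      + ∑ i, ∑ j, μ i j a * star (μ i j b) := by
  simp [Mmat, L, Matrix.sum_apply, Matrix.mul_apply, Pi.single_apply]

lemma Mmat_isHermitian (μ : Vn n) : (Mmat μ).IsHermitian := by
  ext a b
  simp [Matrix.conjTranspose_apply, Mmat_apply, mul_comm]

lemma innerV_glAct_self {μ : Vn n} (hμ : IsSymm μ) (A : Matrix (Fin n) (Fin n) ℂ) :
    innerV (glAct A μ) μ = Matrix.trace (A * Mmat μ) := by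
  have h₁ : ∑ i, ∑ j, ∑ k, (∑ l, A k l * μ i j l) * star (μ i j k)
      = ∑ k, ∑ l, A k l * ∑ i, ∑ j, μ i j l * star (μ i j k) := by
    simp only [Finset.mul_sum, Finset.sum_mul]
    calc _ = ∑ i, ∑ k, ∑ l, ∑ j, A k l * μ i j l * star (μ i j k) := ?_
      _ = ∑ k, ∑ l, ∑ i, ∑ j, A k l * μ i j l * star (μ i j k) := ?_
      _ = _ := by simp only [mul_assoc]
    · refine Finset.sum_congr rfl fun i _ => ?_
      rw [Finset.sum_comm]
      exact Finset.sum_congr rfl fun k _ => Finset.sum_comm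
    · rw [Finset.sum_comm]
      exact Finset.sum_congr rfl fun k _ => Finset.sum_comm
  have h₃ : ∑ i, ∑ j, ∑ k, (∑ l, A l j * μ i l k) * star (μ i j k)
      = ∑ l, ∑ j, A l j * ∑ i, ∑ k, star (μ i j k) * μ i l k := by
    simp only [Finset.mul_sum, Finset.sum_mul]
    calc _ = ∑ i, ∑ l, ∑ j, ∑ k, A l j * μ i l k * star (μ i j k) := ?_
      _ = ∑ l, ∑ j, ∑ i, ∑ k, A l j * μ i l k * star (μ i j k) := ?_
      _ = _ := by simp only [mul_assoc, mul_comm (star _)]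
    · refine Finset.sum_congr rfl fun i _ => ?_
      rw [Finset.sum_comm (γ := Fin n) (s := Finset.univ) (t := Finset.univ)
        (f := fun l j => ∑ k, A l j * μ i l k * star (μ i j k))]
      exact Finset.sum_congr rfl fun j _ => Finset.sum_comm
    · rw [Finset.sum_comm]
      exact Finset.sum_congr rfl fun l _ => Finset.sum_comm
  have h₂ : ∑ i, ∑ j, ∑ k, (∑ l, A l i * μ l j k) * star (μ i j k)
      = ∑ i, ∑ j, ∑ k, (∑ l, A l j * μ i l k) * star (μ i j k) := by
    rw [Finset.sum_comm]
    refine Finset.sum_congr rfl fun i _ => Finset.sum_congr rfl fun j _ =>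
      Finset.sum_congr rfl fun k _ => ?_
    rw [hμ j i k]
    simp_rw [hμ _ i k]
  simp only [innerV, glAct_apply, sub_mul, Finset.sum_sub_distrib]
  rw [h₂, h₁, h₃]
  simp only [Matrix.trace, Matrix.diag, Matrix.mul_apply, Mmat_apply, mul_add,
    Finset.sum_add_distrib, mul_left_comm _ (-2 : ℂ), ← Finset.mul_sum]
  ring

lemma innerV_self (μ : Vn n) : innerV μ μ = (normSqV μ : ℂ) := by
  simp [innerV, normSqV, Complex.mul_conj]

lemma innerV_smul_left (c : ℂ) (μ ν : Vn n) : innerV (c • μ) ν = c * innerV μ ν := by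
  simp [innerV, Finset.mul_sum, mul_assoc]

lemma normSqV_pos {μ : Vn n} (h : μ ≠ 0) : 0 < normSqV μ := by
  obtain ⟨i, hi⟩ := Function.ne_iff.mp h
  obtain ⟨j, hj⟩ := Function.ne_iff.mp hi
  obtain ⟨k, hk⟩ := Function.ne_iff.mp hj
  have h_nonneg := fun i j k => Complex.normSq_nonneg (μ i j k)
  refine Finset.sum_pos' (fun i _ => Finset.sum_nonneg fun j _ => Finset.sum_nonneg fun k _ =>
    h_nonneg i j k) ⟨i, Finset.mem_univ i, ?_⟩
  refine Finset.sum_pos' (fun j _ => Finset.sum_nonneg fun k _ => h_nonneg i j k)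
    ⟨j, Finset.mem_univ j, ?_⟩
  exact Finset.sum_pos' (fun k _ => h_nonneg i j k)
    ⟨k, Finset.mem_univ k, Complex.normSq_pos.mpr hk⟩

lemma trace_Mmat {μ : Vn n} (hμ : IsSymm μ) : Matrix.trace (Mmat μ) = -(normSqV μ : ℂ) := by
  have h_one : glAct 1 μ = (-1 : ℂ) • μ := by
    funext i j k
    simp [glAct_apply, Matrix.one_apply]
  rw [← one_mul (Mmat μ), ← innerV_glAct_self hμ, h_one, innerV_smul_left, innerV_self, neg_one_mul]

lemma Mmat_ne_zero {μ : Vn n} (hμ : IsSymm μ) (h0 : μ ≠ 0) : Mmat μ ≠ 0 := by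
  intro h
  have h_trace := trace_Mmat hμ
  rw [h, Matrix.trace_zero, zero_eq_neg, Complex.ofReal_eq_zero] at h_trace
  exact (normSqV_pos h0).ne' h_trace

open ComplexOrder in
lemma trace_Mmat_sq_pos {μ : Vn n} (hμ : IsSymm μ) (h0 : μ ≠ 0) :
    0 < Matrix.trace (Mmat μ * Mmat μ) := by
  have h_nonneg : 0 ≤ Matrix.trace ((Mmat μ)ᴴ * Mmat μ) :=
    (Matrix.posSemidef_conjTranspose_mul_self (Mmat μ)).trace_nonneg
  have h_ne : Matrix.trace ((Mmat μ)ᴴ * Mmat μ) ≠ 0 := fun h =>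
    Mmat_ne_zero hμ h0 (Matrix.trace_conjTranspose_mul_self_eq_zero_iff.mp h)
  rw [(Mmat_isHermitian μ).eq] at h_nonneg h_ne
  exact lt_of_le_of_ne h_nonneg h_ne.symm

lemma cconst_neg {μ : Vn n} (hμ : IsSymm μ) (h0 : μ ≠ 0) : cconst μ < 0 :=
  div_neg_of_neg_of_pos (neg_neg_of_pos (Complex.pos_iff.mp (trace_Mmat_sq_pos hμ h0)).1)
    (normSqV_pos h0)

lemma Dmat_isHermitian (μ : Vn n) : (Dmat μ).IsHermitian := by
  refine (Mmat_isHermitian μ).sub ?_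
  simp [Matrix.IsHermitian, Matrix.conjTranspose_smul]

lemma eq_neg_cconst_of_glAct_Mmat {μ : Vn n} (hμ : IsSymm μ) (h0 : μ ≠ 0) {c : ℝ}
    (h : glAct (Mmat μ) μ = (c : ℂ) • μ) : c = -cconst μ := by
  have h_trace := innerV_glAct_self hμ (Mmat μ)
  rw [h, innerV_smul_left, innerV_self, ← Complex.ofReal_mul] at h_trace
  rw [cconst, ← h_trace, Complex.ofReal_re, neg_div, neg_neg,
    mul_div_cancel_right₀ c (normSqV_pos h0).ne']

end Vn

/-- a nonzero `μ ∈ V_n` is a soliton iff `D_μ = M_μ - c_μ I` is a derivation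
of `μ`, where `c_μ = -Tr(M_μ²)/‖μ‖²`; in this case `c_μ < 0` and `D_μ` is Hermitian. -/
theorem stmt3 {n : ℕ} (μ : Vn n) (hμ : Vn.IsSymm μ) (h0 : μ ≠ 0) :
    (Vn.IsSoliton μ ↔ Vn.IsDeriv μ (Vn.Dmat μ)) ∧
    (Vn.IsSoliton μ → Vn.cconst μ < 0 ∧ (Vn.Dmat μ).IsHermitian) := by
  refine ⟨?_, fun _ => ⟨Vn.cconst_neg hμ h0, Vn.Dmat_isHermitian μ⟩⟩
  rw [Vn.isDeriv_iff_glAct_eq_zero, Vn.Dmat, Vn.glAct_sub_smul_one]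
  constructor
  · rintro ⟨-, c, hc⟩
    rw [hc, Vn.eq_neg_cconst_of_glAct_Mmat hμ h0 hc, ← add_smul]
    simp
  · intro h
    refine ⟨h0, -Vn.cconst μ, ?_⟩
    rw [eq_neg_of_add_eq_zero_left h, Complex.ofReal_neg, neg_smul]
end
end

section
/- Let μ ∈ 𝒥_n be such that its moment matrix M_μ is negative definite, i.e. ⟨M_μ x, x⟩ < 0 for all nonzero x ∈ ℂⁿ. Then μ admits no nonzero ideal of square zero: every subspace C ⊆ ℂⁿ with μ(ℂⁿ, C) ⊆ C and μ(C, C) = 0 is the zero subspace. -/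
open Matrix

noncomputable section

namespace Vn

/-- The sum of the Hilbert-Schmidt products of two families of matrices is unchanged when the
family index is swapped with the column index in both families. -/
lemma sum_trace_conjTranspose_mul_swap {n : ℕ} (X Y X' Y' : Fin n → Matrix (Fin n) (Fin n) ℂ)
    (hX : ∀ i k j, X' i k j = X j k i) (hY : ∀ i k j, Y' i k j = Y j k i) :
    ∑ i, ((X' i)ᴴ * Y' i).trace = ∑ i, ((X i)ᴴ * Y i).trace := by
  simp only [Matrix.trace, Matrix.diag_apply, Matrix.mul_apply, Matrix.conjTranspose_apply, hX, hY]
  rw [Finset.sum_comm]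

open scoped ComplexOrder in
lemma trace_conjTranspose_mul_self_re_nonneg {n : ℕ} (X : Matrix (Fin n) (Fin n) ℂ) :
    0 ≤ (Xᴴ * X).trace.re :=
  (Complex.le_def.mp (Matrix.posSemidef_conjTranspose_mul_self X).trace_nonneg).1

/-- If `P` is the orthogonal projection onto a square-zero ideal of the commutative algebra with
left multiplications `A i`, then the moment matrix has nonnegative trace against `P`. -/
lemma trace_moment_mul_proj_nonneg {n : ℕ} (A : Fin n → Matrix (Fin n) (Fin n) ℂ)
    (P : Matrix (Fin n) (Fin n) ℂ) (hA : ∀ i k j, A i k j = A j k i)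
    (hPs : Pᴴ = P) (hPP : P * P = P) (hideal : ∀ i, P * (A i * P) = A i * P)
    (hsq : ∀ i, (Matrix.of fun k j => (A j * P) k i) * P = 0) :
    0 ≤ (((-2 : ℂ) • ∑ i, (A i)ᴴ * A i + ∑ i, A i * (A i)ᴴ) * P).trace.re := by
  set V : Fin n → Matrix (Fin n) (Fin n) ℂ := fun i => Matrix.of fun k j => (A j * P) k i with hV
  have hU : ∀ i k j, (P * A i) k j = (P * A j) k i := by
    intro i k j
    simp only [Matrix.mul_apply, hA i _ j]
  have hideal' : ∀ i, P * (A i)ᴴ * P = P * (A i)ᴴ := by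
    intro i
    have := congrArg Matrix.conjTranspose (hideal i)
    simpa [Matrix.conjTranspose_mul, hPs] using this
  have tUU : ∀ i, ((P * A i)ᴴ * (P * A i)).trace = (A i * (A i)ᴴ * P).trace := by
    intro i
    rw [Matrix.conjTranspose_mul, hPs, Matrix.mul_assoc, ← Matrix.mul_assoc P P, hPP,
      ← Matrix.mul_assoc, Matrix.trace_mul_comm, Matrix.mul_assoc]
  have tUW : ∀ i, ((P * A i)ᴴ * (A i * P)).trace = ((A i)ᴴ * A i * P).trace := by
    intro i
    rw [Matrix.conjTranspose_mul, hPs, Matrix.mul_assoc, hideal, Matrix.mul_assoc]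
  have tWU : ∀ i, ((A i * P)ᴴ * (P * A i)).trace = ((A i)ᴴ * A i * P).trace := by
    intro i
    rw [Matrix.conjTranspose_mul, hPs, ← Matrix.mul_assoc, hideal', Matrix.mul_assoc,
      Matrix.trace_mul_comm]
  have tWW : ∀ i, ((A i * P)ᴴ * (A i * P)).trace = ((A i)ᴴ * A i * P).trace := by
    intro i
    rw [Matrix.conjTranspose_mul, hPs, Matrix.mul_assoc, Matrix.trace_mul_comm,
      Matrix.mul_assoc, Matrix.mul_assoc, hPP, ← Matrix.mul_assoc]
  have tWV : ∀ i, ((A i * P)ᴴ * V i).trace = 0 := by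
    intro i
    rw [Matrix.conjTranspose_mul, hPs, Matrix.mul_assoc, Matrix.trace_mul_comm,
      Matrix.mul_assoc, hsq, Matrix.mul_zero, Matrix.trace_zero]
  have tVW : ∀ i, ((V i)ᴴ * (A i * P)).trace = 0 := by
    intro i
    rw [← Matrix.conjTranspose_conjTranspose (A i * P), ← Matrix.conjTranspose_mul,
      Matrix.trace_conjTranspose, tWV, star_zero]
  have sVV := sum_trace_conjTranspose_mul_swap (fun i => A i * P) (fun i => A i * P) V V
    (fun _ _ _ => rfl) (fun _ _ _ => rfl)
  have sUV := sum_trace_conjTranspose_mul_swap (fun i => P * A i) (fun i => A i * P)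
    (fun i => P * A i) V hU (fun _ _ _ => rfl)
  have sVU := sum_trace_conjTranspose_mul_swap (fun i => A i * P) (fun i => P * A i)
    V (fun i => P * A i) (fun _ _ _ => rfl) hU
  have key : ∑ i, ((P * A i - V i - A i * P)ᴴ * (P * A i - V i - A i * P)).trace
      = (((-2 : ℂ) • ∑ i, (A i)ᴴ * A i + ∑ i, A i * (A i)ᴴ) * P).trace := by
    simp only [Matrix.conjTranspose_sub, Matrix.sub_mul, Matrix.mul_sub, Matrix.trace_sub,
      Finset.sum_sub_distrib, sVV, sUV, sVU, tUU, tUW, tWU, tWW, tWV, tVW, Matrix.add_mul,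
      Matrix.smul_mul, Matrix.sum_mul, Matrix.trace_add, Matrix.trace_smul, Matrix.trace_sum,
      smul_eq_mul, Finset.sum_const_zero]
    ring
  rw [← key, Complex.re_sum]
  exact Finset.sum_nonneg fun i _ => trace_conjTranspose_mul_self_re_nonneg _

/-- Every subspace of `ℂⁿ` has an orthonormal basis, here the columns of a matrix. -/
lemma exists_orthonormal_columns {n : ℕ} (C : Submodule ℂ (Fin n → ℂ)) :
    ∃ (d : ℕ) (N : Matrix (Fin n) (Fin d) ℂ), Nᴴ * N = 1 ∧ (∀ k, N.col k ∈ C) ∧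
      ∀ y ∈ C, N *ᵥ (Nᴴ *ᵥ y) = y := by
  let e := WithLp.linearEquiv 2 ℂ (Fin n → ℂ)
  let C' : Submodule ℂ (EuclideanSpace ℂ (Fin n)) := C.comap e.toLinearMap
  let b := stdOrthonormalBasis ℂ C'
  refine ⟨_, Matrix.of fun j k => (b k : EuclideanSpace ℂ (Fin n)) j, ?_, ?_, ?_⟩
  · ext k l
    have := orthonormal_iff_ite.mp b.orthonormal k l
    rw [Submodule.coe_inner, PiLp.inner_apply] at this
    rw [Matrix.one_apply, ← this]
    simp [Matrix.mul_apply, mul_comm]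
  · exact fun k => (b k).2
  · intro y hy
    have hb := b.sum_repr' (⟨WithLp.toLp 2 y, hy⟩ : C')
    ext j
    have hj := congrArg (fun z : C' => (z : EuclideanSpace ℂ (Fin n)) j) hb
    simp only [Submodule.coe_sum, Submodule.coe_smul, Submodule.coe_inner, WithLp.ofLp_sum,
      Finset.sum_apply, PiLp.smul_apply, smul_eq_mul, PiLp.inner_apply] at hj
    rw [← hj]
    simp [Matrix.mulVec, dotProduct, mul_comm]

lemma L_mulVec {n : ℕ} (μ : Vn n) (x y : Fin n → ℂ) : L μ x *ᵥ y = mul μ x y := by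
  ext k
  simp only [Matrix.mulVec, dotProduct, L, Matrix.of_apply, mul, Finset.sum_mul]
  rw [Finset.sum_comm]
  exact Finset.sum_congr rfl fun i _ => Finset.sum_congr rfl fun j _ => by ring

lemma L_single_apply {n : ℕ} (μ : Vn n) (i k j : Fin n) : L μ (Pi.single i 1) k j = μ i j k := by
  simp [L, Pi.single_apply]

end Vn

/-- if `μ ∈ 𝒥_n` has negative-definite moment matrix, then every ideal of
square zero of `μ` is trivial. -/
theorem stmt7 {n : ℕ} (μ : Vn n) (hJ : Vn.IsJordan μ)
    (hneg : ∀ x : Fin n → ℂ, x ≠ 0 → (Vn.herm (Vn.Mmat μ *ᵥ x) x).re < 0)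
    (C : Submodule ℂ (Fin n → ℂ))
    (hideal : ∀ x y, y ∈ C → Vn.mul μ x y ∈ C)
    (hsq : ∀ x y, x ∈ C → y ∈ C → Vn.mul μ x y = 0) :
    C = ⊥ := by
  obtain ⟨d, N, hN, hNC, hproj⟩ := Vn.exists_orthonormal_columns C
  have hcol : ∀ {m : ℕ} (Y : Matrix (Fin n) (Fin m) ℂ), (∀ k, Y.col k ∈ C) →
      N * Nᴴ * Y = Y := by
    intro m Y hY
    ext j k
    rw [Matrix.mul_assoc]
    exact congrFun (hproj _ (hY k)) j
  have hsymm : ∀ i k j, Vn.L μ (Pi.single i 1) k j = Vn.L μ (Pi.single j 1) k i := by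
    intro i k j
    rw [Vn.L_single_apply, Vn.L_single_apply, hJ.1]
  have hmem : ∀ i k, (Vn.L μ (Pi.single i 1) * N).col k ∈ C := by
    intro i k
    have : (Vn.L μ (Pi.single i 1) * N).col k = Vn.mul μ (Pi.single i 1) (N.col k) := by
      rw [← Vn.L_mulVec]; rfl
    rw [this]
    exact hideal _ _ (hNC k)
  have hPmem : ∀ v, (N * Nᴴ) *ᵥ v ∈ C := by
    intro v
    rw [← Matrix.mulVec_mulVec, Matrix.mulVec_eq_sum]
    refine C.sum_mem fun k _ => ?_
    rw [op_smul_eq_smul]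
    exact C.smul_mem _ (hNC k)
  have hPcol : ∀ i, (N * Nᴴ).col i ∈ C := by
    intro i
    rw [← Matrix.mulVec_single_one]
    exact hPmem _
  have hnonneg := Vn.trace_moment_mul_proj_nonneg (fun i => Vn.L μ (Pi.single i 1)) (N * Nᴴ)
    hsymm (by simp) (hcol _ hPcol) (fun i => by
      rw [← Matrix.mul_assoc _ N, ← Matrix.mul_assoc, hcol _ (hmem i)]) (fun i => by
      have hV : (Matrix.of fun k j => (Vn.L μ (Pi.single j 1) * (N * Nᴴ)) k i)
          = Vn.L μ ((N * Nᴴ).col i) := by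
        ext k j
        rw [Matrix.of_apply, Matrix.mul_apply]
        simp only [Vn.L_single_apply]
        exact Finset.sum_congr rfl fun l _ => by rw [hJ.1 j l k, mul_comm, Matrix.col_apply]
      rw [hV]
      ext k j
      exact congrFun ((Vn.L_mulVec μ _ _).trans (hsq _ _ (hPcol i) (hPcol j))) k)
  change 0 ≤ (Vn.Mmat μ * (N * Nᴴ)).trace.re at hnonneg
  have htrace : (Vn.Mmat μ * (N * Nᴴ)).trace
      = ∑ k, Vn.herm (Vn.Mmat μ *ᵥ N.col k) (N.col k) := by
    rw [← Matrix.mul_assoc, Matrix.trace_mul_comm]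
    simp only [Matrix.trace, Matrix.diag_apply, Matrix.mul_apply (M := Nᴴ), Vn.herm]
    refine Finset.sum_congr rfl fun k _ => Finset.sum_congr rfl fun j _ => ?_
    rw [mul_comm]; rfl
  have hNne : ∀ k, N.col k ≠ 0 := by
    intro k hk
    have h1 : (Nᴴ * N) k k = 1 := by rw [hN, Matrix.one_apply_eq]
    have h0 : ∀ j, N j k = 0 := fun j => congrFun hk j
    simp [Matrix.mul_apply, h0] at h1
  rw [htrace, Complex.re_sum] at hnonneg
  rcases isEmpty_or_nonempty (Fin d) with hd | hd
  · rw [Submodule.eq_bot_iff]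
    intro y hy
    rw [← hproj y hy, Matrix.mulVec_eq_sum, Finset.univ_eq_empty, Finset.sum_empty]
  · exact absurd hnonneg (not_le.mpr (Finset.sum_neg (fun k _ => hneg _ (hNne k))
      Finset.univ_nonempty))
end
end

section
/- Let n ≥ 2 and let μ ∈ 𝒥_n be nonzero and not isomorphic to μ_hyp (i.e., μ ∉ GL(n,ℂ)·μ_hyp). Then μ degenerates to μ_Heis: μ_Heis lies in the closure of the orbit GL(n,ℂ)·μ in V_n. -/
open Matrix

noncomputable section

/-- the Heisenberguian Jordan algebra `μ_Heis`: `μ(e₀,e₀) = e₁`, all other products of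
basis vectors zero -/
def muHeis (n : ℕ) : Vn n := fun i j k =>
  if i.val = 0 ∧ j.val = 0 ∧ k.val = 1 then 1 else 0

/-- the hyperbolic Jordan algebra `μ_hyp`: `μ(e₀,e₀) = e₀`, `μ(e₀,eᵢ) = μ(eᵢ,e₀) = (1/2)eᵢ`
for `i ≥ 1`, all other products of basis vectors zero -/
def muHyp (n : ℕ) : Vn n := fun i j k =>
  if i.val = 0 ∧ j.val = 0 ∧ k.val = 0 then 1
  else if i.val = 0 ∧ j = k then 1/2
  else if j.val = 0 ∧ i = k then 1/2
  else 0

open Filter Topology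

/-- A bijective linear map carries any finite linearly independent family to any other. -/
theorem LinearIndependent.exists_linearEquiv_apply_eq {K V ι : Type*} [Field K] [AddCommGroup V]
    [Module K V] [Finite ι] {v w : ι → V} (hv : LinearIndependent K v)
    (hw : LinearIndependent K w) : ∃ g : V ≃ₗ[K] V, ∀ i, g (v i) = w i := by
  have : FiniteDimensional K (Submodule.span K (Set.range v)) :=
    FiniteDimensional.span_of_finite K (Set.finite_range v)
  obtain ⟨g, hg⟩ := Submodule.exists_linearEquiv_restrict_eq
    (hv.linearCombinationEquiv.symm ≪≫ₗ hw.linearCombinationEquiv)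
  refine ⟨g, fun i => ?_⟩
  have hvi : hv.linearCombinationEquiv (Finsupp.single i 1)
      = ⟨v i, Submodule.subset_span (Set.mem_range_self i)⟩ := by
    ext1; simp
  have := hg (hv.linearCombinationEquiv (Finsupp.single i 1))
  rw [LinearEquiv.trans_apply, LinearEquiv.symm_apply_apply, hvi] at this
  simpa using this.symm

/-- The general linear group acts transitively on linearly independent families. -/
theorem LinearIndependent.exists_GL_mulVec_eq {K m ι : Type*} [Field K] [Fintype m]
    [DecidableEq m] [Finite ι] {v w : ι → m → K} (hv : LinearIndependent K v)
    (hw : LinearIndependent K w) : ∃ g : GL m K, ∀ i, (g : Matrix m m K) *ᵥ v i = w i := by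
  obtain ⟨g, hg⟩ := hv.exists_linearEquiv_apply_eq hw
  refine ⟨⟨LinearMap.toMatrix' g, LinearMap.toMatrix' g.symm, ?_, ?_⟩, fun i => ?_⟩
  · rw [← LinearMap.toMatrix'_comp]; simp
  · rw [← LinearMap.toMatrix'_comp]; simp
  · simp [LinearMap.toMatrix'_mulVec, hg]

namespace Vn

variable {n : ℕ}

theorem mul_single_single (μ : Vn n) (i j : Fin n) :
    mul μ (Pi.single i 1) (Pi.single j 1) = μ i j := by
  ext k
  simp [mul, Pi.single_apply, Finset.sum_ite_eq']

theorem mul_add_left (μ : Vn n) (x y z : Fin n → ℂ) :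
    mul μ (x + y) z = mul μ x z + mul μ y z := by
  ext k
  simp [mul, add_mul, Finset.sum_add_distrib]

theorem mul_add_right (μ : Vn n) (x y z : Fin n → ℂ) :
    mul μ x (y + z) = mul μ x y + mul μ x z := by
  ext k
  simp [mul, add_mul, mul_add, Finset.sum_add_distrib]

theorem mul_smul_left (μ : Vn n) (a : ℂ) (x y : Fin n → ℂ) :
    mul μ (a • x) y = a • mul μ x y := by
  ext k
  simp [mul, Finset.mul_sum, mul_assoc]

theorem mul_smul_right (μ : Vn n) (a : ℂ) (x y : Fin n → ℂ) :
    mul μ x (a • y) = a • mul μ x y := by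
  ext k
  simp only [mul, Pi.smul_apply, smul_eq_mul, Finset.mul_sum]
  refine Finset.sum_congr rfl fun i _ => Finset.sum_congr rfl fun j _ => ?_
  ring

/-- A diagonal change of basis rescales the structure constants of a point of the orbit. -/
theorem rescale_mem_orbit (μ : Vn n) (g : GL (Fin n) ℂ) (d : Fin n → ℂˣ) :
    (fun i j k => (d i * d j / d k : ℂ) * gAct g μ i j k) ∈ orbit μ := by
  let D : GL (Fin n) ℂ :=
    ⟨diagonal fun i => ((d i)⁻¹ : ℂˣ), diagonal fun i => (d i : ℂ), by simp, by simp⟩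
  refine ⟨D * g, ?_⟩
  have hD : ∀ i, (↑(D * g)⁻¹ : Matrix (Fin n) (Fin n) ℂ) *ᵥ Pi.single i 1
      = (d i : ℂ) • (↑g⁻¹ : Matrix (Fin n) (Fin n) ℂ) *ᵥ Pi.single i 1 := fun i => by
    have : (↑D⁻¹ : Matrix (Fin n) (Fin n) ℂ) *ᵥ Pi.single i 1
        = (d i : ℂ) • Pi.single i 1 := by
      change diagonal (fun i => (d i : ℂ)) *ᵥ Pi.single i 1 = _
      ext k
      by_cases h : k = i
      · subst h; simp [mulVec_diagonal]
      · simp [mulVec_diagonal, h]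
    rw [_root_.mul_inv_rev, Units.val_mul, ← mulVec_mulVec, this, mulVec_smul]
  funext i j k
  simp only [gAct, hD, mul_smul_left, mul_smul_right, mulVec_smul]
  change _ = (_ • _ • ((diagonal fun i => (((d i)⁻¹ : ℂˣ) : ℂ)) * _) *ᵥ _) k
  rw [← mulVec_mulVec]
  simp only [Pi.smul_apply, mulVec_diagonal, smul_eq_mul, Units.val_inv_eq_inv_val]
  ring

/-- If some vector is independent of its square, the algebra degenerates to `muHeis`. -/
theorem muHeis_mem_closure_orbit (hn : 2 ≤ n) (μ : Vn n) (x : Fin n → ℂ)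
    (hx : LinearIndependent ℂ ![x, mul μ x x]) : muHeis n ∈ closure (orbit μ) := by
  let i₀ : Fin n := ⟨0, by omega⟩
  let i₁ : Fin n := ⟨1, by omega⟩
  have hi : Function.Injective ![i₀, i₁] := by
    intro a b hab
    fin_cases a <;> fin_cases b <;> simp_all [i₀, i₁]
  have he : LinearIndependent ℂ ((fun i : Fin n => (Pi.single i 1 : Fin n → ℂ)) ∘ ![i₀, i₁]) :=
    (Pi.linearIndependent_single_one (Fin n) ℂ).comp _ hi
  obtain ⟨P, hP⟩ := he.exists_GL_mulVec_eq hx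
  have hP₀ : (P : Matrix (Fin n) (Fin n) ℂ) *ᵥ Pi.single i₀ 1 = x := hP 0
  have hP₁ : (P : Matrix (Fin n) (Fin n) ℂ) *ᵥ Pi.single i₁ 1 = mul μ x x := hP 1
  have hν : ∀ k, gAct P⁻¹ μ i₀ i₀ k = (Pi.single i₁ 1 : Fin n → ℂ) k := fun k => by
    rw [gAct, inv_inv, hP₀, ← hP₁, mulVec_mulVec, ← Units.val_mul, inv_mul_cancel,
      Units.val_one, one_mulVec]
  let w : Fin n → ℕ := fun i => if i.val = 0 then 1 else 2
  refine mem_closure_of_tendsto (b := 𝓝[≠] (0 : ℂ))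
    (f := fun t i j k => (t ^ w i * t ^ w j / t ^ w k) * gAct P⁻¹ μ i j k) ?_ ?_
  · simp only [tendsto_pi_nhds]
    intro i j k
    by_cases hij : i.val = 0 ∧ j.val = 0
    · obtain rfl : i = i₀ := Fin.ext hij.1
      obtain rfl : j = i₀ := Fin.ext hij.2
      refine tendsto_nhds_of_eventually_eq ?_
      filter_upwards [self_mem_nhdsWithin] with t (ht : t ≠ 0)
      rw [hν]
      by_cases hk : k.val = 1
      · obtain rfl : k = i₁ := Fin.ext hk
        simp [w, muHeis, i₀, i₁]
        field_simp
      · have : k ≠ i₁ := fun h => hk (by rw [h])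
        simp [muHeis, hk, this]
    · have hH : muHeis n i j k = 0 := by
        rw [muHeis, if_neg fun h => hij ⟨h.1, h.2.1⟩]
      have hw : w k < w i + w j := by
        simp only [w]; split_ifs <;> omega
      rw [hH]
      have hlim : Tendsto (fun t : ℂ => t ^ (w i + w j - w k) * gAct P⁻¹ μ i j k)
          (𝓝[≠] 0) (𝓝 0) := by
        refine Tendsto.mono_left (Continuous.tendsto' (by fun_prop) _ _ ?_) nhdsWithin_le_nhds
        rw [zero_pow (by omega), zero_mul]
      refine hlim.congr' ?_
      filter_upwards [self_mem_nhdsWithin] with t ht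
      rw [pow_sub₀ t ht hw.le, pow_add, div_eq_mul_inv]
  · filter_upwards [self_mem_nhdsWithin] with t (ht : t ≠ 0)
    simpa only [Units.val_pow_eq_pow_val, Units.val_mk0] using
      rescale_mem_orbit μ P⁻¹ fun i => Units.mk0 t ht ^ w i

/-- If every vector is proportional to its square, the structure constants are determined by the
eigenvalues on the standard basis. -/
theorem apply_eq_of_mul_self_eq_smul {μ : Vn n} (hs : IsSymm μ)
    (h : ∀ x, ∃ c : ℂ, mul μ x x = c • x) (i j k : Fin n) :
    μ i j k = 1 / 2 * (μ i i i * (Pi.single j 1 : Fin n → ℂ) k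
      + μ j j j * (Pi.single i 1 : Fin n → ℂ) k) := by
  have hsq : ∀ i k, μ i i k = μ i i i * (Pi.single i 1 : Fin n → ℂ) k := fun i k => by
    obtain ⟨c, hc⟩ := h (Pi.single i 1)
    rw [mul_single_single] at hc
    simp [hc]
  rcases eq_or_ne i j with rfl | hij
  · rw [hsq i k]; ring
  have hmul : ∀ s : ℂ, ∃ c : ℂ, ∀ k, μ i i k + 2 * s * μ i j k + s ^ 2 * μ j j k
      = c * ((Pi.single i 1 : Fin n → ℂ) k + s * (Pi.single j 1 : Fin n → ℂ) k) := fun s => by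
    obtain ⟨c, hc⟩ := h (Pi.single i 1 + s • Pi.single j 1)
    refine ⟨c, fun k => ?_⟩
    have := congrFun hc k
    simp only [mul_add_left, mul_add_right, mul_smul_left, mul_smul_right, mul_single_single,
      Pi.add_apply, Pi.smul_apply, smul_eq_mul, hs j i k] at this
    rw [← this]; ring
  obtain ⟨c, hc⟩ := hmul 1
  obtain ⟨c', hc'⟩ := hmul (-1)
  have e₁ := hc i
  have e₂ := hc j
  have e₃ := hc' i
  have e₄ := hc' j
  have e₅ := hc k
  simp only [hsq i j, hsq j i, hsq i k, hsq j k, Pi.single_eq_same, Pi.single_eq_of_ne hij,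
    Pi.single_eq_of_ne hij.symm] at e₁ e₂ e₃ e₄ e₅
  by_cases hki : k = i
  · subst hki
    simp only [Pi.single_eq_same, Pi.single_eq_of_ne hij]
    linear_combination (e₁ - e₂ - e₃ - e₄) / 4
  by_cases hkj : k = j
  · subst hkj
    simp only [Pi.single_eq_same, Pi.single_eq_of_ne hij.symm]
    linear_combination (e₂ - e₁ - e₃ - e₄) / 4
  simp only [Pi.single_eq_of_ne hki, Pi.single_eq_of_ne hkj] at e₅ ⊢
  linear_combination e₅ / 2

theorem mul_muHyp (i₀ : Fin n) (h₀ : i₀.val = 0) (x y : Fin n → ℂ) :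
    mul (muHyp n) x y = (1 / 2 : ℂ) • (x i₀ • y + y i₀ • x) := by
  have hμ : ∀ i j k, muHyp n i j k = (1 / 2 : ℂ) *
      ((if i = i₀ then 1 else 0) * (if j = k then 1 else 0)
        + (if j = i₀ then 1 else 0) * (if i = k then 1 else 0)) := fun i j k => by
    have hv : ∀ i : Fin n, i.val = 0 ↔ i = i₀ := fun i => by rw [Fin.ext_iff, h₀]
    simp only [muHyp, hv]
    by_cases hi : i = i₀ <;> by_cases hj : j = i₀ <;> by_cases hk : k = i₀ <;>
      (simp_all [eq_comm]; try norm_num)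
  ext k
  simp only [mul, hμ, Pi.smul_apply, Pi.add_apply, smul_eq_mul, mul_add, Finset.sum_add_distrib]
  congr 1
  · simp [Finset.sum_ite_eq']; ring
  · simp [Finset.sum_ite_eq']; ring

/-- A nonzero algebra in which every vector is proportional to its square is isomorphic to
`muHyp`. -/
theorem mem_orbit_muHyp {μ : Vn n} (hs : IsSymm μ) (h0 : μ ≠ 0)
    (h : ∀ x, ∃ c : ℂ, mul μ x x = c • x) : μ ∈ orbit (muHyp n) := by
  have hμ := apply_eq_of_mul_self_eq_smul hs h
  have hl : (fun i => μ i i i) ≠ 0 := fun hl => h0 <| by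
    funext i j k
    have hl' : ∀ i, μ i i i = 0 := congrFun hl
    rw [hμ i j k, hl', hl']
    simp
  obtain ⟨p, -⟩ := Function.ne_iff.mp hl
  let i₀ : Fin n := ⟨0, p.pos⟩
  have he : LinearIndependent ℂ (fun _ : Unit => (Pi.single i₀ 1 : Fin n → ℂ)) :=
    LinearIndependent.of_subsingleton () (by simp)
  obtain ⟨P, hP⟩ := he.exists_GL_mulVec_eq
    (LinearIndependent.of_subsingleton (v := fun _ : Unit => fun i => μ i i i) () hl)
  obtain ⟨H, hH⟩ := ((isUnit_transpose _).mpr P.isUnit : IsUnit (P : Matrix (Fin n) (Fin n) ℂ)ᵀ)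
  have hrow : ∀ i, ((H : Matrix (Fin n) (Fin n) ℂ) *ᵥ Pi.single i 1) i₀ = μ i i i := fun i => by
    rw [hH, ← congrFun (hP ()) i]
    simp
  refine ⟨H⁻¹, ?_⟩
  funext i j k
  have hinv : ∀ x, (↑H⁻¹ : Matrix (Fin n) (Fin n) ℂ) *ᵥ (H : Matrix (Fin n) (Fin n) ℂ) *ᵥ x = x :=
    fun x => by
      rw [mulVec_mulVec, ← Units.val_mul, inv_mul_cancel, Units.val_one, one_mulVec]
  simp only [gAct, inv_inv, mul_muHyp i₀ rfl, hrow, mulVec_smul, mulVec_add, hinv]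
  exact hμ i j k

end Vn

/-- every nonzero Jordan algebra of dimension `n ≥ 2` which is not
isomorphic to `μ_hyp` degenerates to `μ_Heis`. -/
theorem stmt8 {n : ℕ} (hn : 2 ≤ n) (μ : Vn n) (hJ : Vn.IsJordan μ) (h0 : μ ≠ 0)
    (hnot : μ ∉ Vn.orbit (muHyp n)) :
    muHeis n ∈ closure (Vn.orbit μ) := by
  by_contra hcl
  refine hnot (Vn.mem_orbit_muHyp hJ.1 h0 fun x => ?_)
  rcases eq_or_ne x 0 with rfl | hx
  · exact ⟨0, by ext k; simp [Vn.mul]⟩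
  by_contra! hc
  exact hcl (Vn.muHeis_mem_closure_orbit hn μ x
    ((LinearIndependent.pair_iff' hx).mpr fun c => (hc c).symm))
end
end

section
/- For n ≥ 2, neither of the Jordan algebras μ_Heis and μ_hyp degenerates to the other: μ_Heis does not lie in the closure of the orbit GL(n,ℂ)·μ_hyp in V_n, and μ_hyp does not lie in the closure of the orbit GL(n,ℂ)·μ_Heis in V_n. -/
open Matrix

noncomputable section

theorem muHyp_apply {n : ℕ} [NeZero n] (i j k : Fin n) :
    muHyp n i j k =
      (if i = 0 then if j = k then 1 / 2 else 0 else 0) +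
        (if j = 0 then if i = k then 1 / 2 else 0 else 0) := by
  have h0 : ∀ a : Fin n, a.val = 0 ↔ a = 0 := fun a => Fin.val_eq_zero_iff
  simp only [muHyp, h0]
  grind

/-- In the hyperbolic algebra every square `x²` is the multiple `x₀ • x` of `x`. -/
theorem mul_muHyp_self {n : ℕ} [NeZero n] (x : Fin n → ℂ) :
    Vn.mul (muHyp n) x x = x 0 • x := by
  ext k
  simp only [Vn.mul, muHyp_apply, mul_add, Finset.sum_add_distrib, mul_ite, mul_zero,
    Finset.sum_ite_eq', Finset.sum_ite_irrel, Finset.sum_const_zero, Finset.mem_univ, if_true,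
    Pi.smul_apply, smul_eq_mul]
  ring

theorem mul_muHeis {n : ℕ} (p q : Fin n) (hp : p.val = 0) (hq : q.val = 1) (x y : Fin n → ℂ) :
    Vn.mul (muHeis n) x y = Pi.single q (x p * y p) := by
  ext k
  have h0 : ∀ a : Fin n, a.val = 0 ↔ a = p := fun a => by rw [Fin.ext_iff, hp]
  have h1 : k.val = 1 ↔ k = q := by rw [Fin.ext_iff, hq]
  simp only [Vn.mul, muHeis, h0, h1, Pi.single_apply, ite_and, mul_ite, mul_one, mul_zero,
    Finset.sum_ite_eq', Finset.sum_ite_irrel, Finset.sum_const_zero, Finset.mem_univ, if_true]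

/-- In the orbit of the hyperbolic algebra every square is proportional to its base. -/
theorem gAct_muHyp_self {n : ℕ} [NeZero n] (g : GL (Fin n) ℂ) {i k : Fin n} (hik : k ≠ i) :
    Vn.gAct g (muHyp n) i i k = 0 := by
  simp only [Vn.gAct, mul_muHyp_self, mulVec_smul, mulVec_mulVec, Units.mul_inv, one_mulVec]
  simp [hik]

/-- In the orbit of the Heisenberg algebra all left multiplications are traceless. -/
theorem sum_gAct_muHeis {n : ℕ} (hn : 2 ≤ n) (g : GL (Fin n) ℂ) (i : Fin n) :
    ∑ k, Vn.gAct g (muHeis n) i k k = 0 := by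
  let p : Fin n := ⟨0, by omega⟩
  let q : Fin n := ⟨1, by omega⟩
  have hinv : ∑ k, (↑g⁻¹ : Matrix (Fin n) (Fin n) ℂ) p k * (g : Matrix (Fin n) (Fin n) ℂ) k q
      = 0 := by
    rw [← Matrix.mul_apply, Units.inv_mul, Matrix.one_apply_ne (by simp [p, q])]
  calc ∑ k, Vn.gAct g (muHeis n) i k k
      = ∑ k, (↑g⁻¹ : Matrix (Fin n) (Fin n) ℂ) p i *
          ((↑g⁻¹ : Matrix (Fin n) (Fin n) ℂ) p k * (g : Matrix (Fin n) (Fin n) ℂ) k q) := by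
        refine Finset.sum_congr rfl fun k _ => ?_
        simp only [Vn.gAct, mul_muHeis p q rfl rfl, mulVec_single, col_apply,
          Pi.smul_apply, MulOpposite.smul_eq_mul_unop, MulOpposite.unop_op]
        ring
    _ = 0 := by rw [← Finset.mul_sum, hinv, mul_zero]

theorem sum_muHyp_zero {n : ℕ} [NeZero n] :
    ∑ k, muHyp n 0 k k = (n + 1) / 2 := by
  simp only [muHyp_apply, Finset.sum_add_distrib, if_true]
  simp [eq_comm]
  ring

/-- for `n ≥ 2`, neither of `μ_Heis` and `μ_hyp` degenerates to the other. -/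
theorem stmt9 {n : ℕ} (hn : 2 ≤ n) :
    muHeis n ∉ closure (Vn.orbit (muHyp n)) ∧
    muHyp n ∉ closure (Vn.orbit (muHeis n)) := by
  have : NeZero n := ⟨by omega⟩
  constructor
  · intro h
    let q : Fin n := ⟨1, by omega⟩
    have hclosed : IsClosed {μ : Vn n | μ 0 0 q = 0} :=
      isClosed_eq (by fun_prop) continuous_const
    have hsub : Vn.orbit (muHyp n) ⊆ {μ : Vn n | μ 0 0 q = 0} := by
      rintro _ ⟨g, rfl⟩
      exact gAct_muHyp_self g (by simp [q, Fin.ext_iff])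
    have := closure_minimal hsub hclosed h
    simp [muHeis, q] at this
  · intro h
    have hclosed : IsClosed {μ : Vn n | ∑ k, μ 0 k k = 0} :=
      isClosed_eq (by fun_prop) continuous_const
    have hsub : Vn.orbit (muHeis n) ⊆ {μ : Vn n | ∑ k, μ 0 k k = 0} := by
      rintro _ ⟨g, rfl⟩
      exact sum_gAct_muHeis hn g 0
    have := closure_minimal hsub hclosed h
    rw [Set.mem_ofPred_eq, sum_muHyp_zero] at this
    have : (n : ℂ) + 1 = 0 := by simpa using this
    exact Nat.cast_add_one_ne_zero n this
end
end
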